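/- Let s = σ + it with σ > 1 and t real, and set s1 = σ1 + it. If z is a complex number with Im z = t and 1/2 ≤ Re z < 1, then Re(1/(s−1+conj(z))) − κ·F(s1,z) ≥ 0. -/

import Mathlib

namespace ZFR

noncomputable def kappa : ℝ := 1 / Real.sqrt 5

noncomputable def sigma1 (σ : ℝ) : ℝ := 1 / 2 + Real.sqrt (1 + 4 * σ ^ 2) / 2

/-- `F(s,z) = Re( 1/(s-z) + 1/(s-1+conj z) )`. -/
noncomputable def F (s z : ℂ) : ℝ :=
  (1 / (s - z) + 1 / (s - 1 + (starRingEnd ℂ) z)).re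

/-- The real form of Stechkin's inequality: on a horizontal line all the
quantities involved are real. -/
theorem kappa_mul_add_le {σ x : ℝ} (hσ : 1 < σ) (h0 : 1 / 2 ≤ x) (h1 : x < 1) :
    kappa * (1 / (sigma1 σ - x) + 1 / (sigma1 σ - 1 + x)) ≤ 1 / (σ - 1 + x) := by
  have h5 : 0 < Real.sqrt 5 := by positivity
  have hr : Real.sqrt (1 + 4 * σ ^ 2) ^ 2 = 1 + 4 * σ ^ 2 := Real.sq_sqrt (by positivity)
  have hle : Real.sqrt (1 + 4 * σ ^ 2) ≤ Real.sqrt 5 * σ := by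
    rw [← Real.sqrt_sq (by linarith : (0 : ℝ) ≤ σ), ← Real.sqrt_mul (by norm_num),
      Real.sqrt_sq (by linarith : (0 : ℝ) ≤ σ)]
    exact Real.sqrt_le_sqrt (by nlinarith)
  have hlow : 1 < Real.sqrt (1 + 4 * σ ^ 2) := Real.lt_sqrt_of_sq_lt (by nlinarith)
  unfold kappa sigma1
  generalize Real.sqrt (1 + 4 * σ ^ 2) = r at *
  have ha : 0 < 1 / 2 + r / 2 - x := by linarith
  have hb : 0 < 1 / 2 + r / 2 - 1 + x := by linarith
  have hprod : (1 / 2 + r / 2 - x) * (1 / 2 + r / 2 - 1 + x) = σ ^ 2 + x - x ^ 2 := by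
    linear_combination hr / 4
  have hsum : 1 / (1 / 2 + r / 2 - x) + 1 / (1 / 2 + r / 2 - 1 + x)
      = r / (σ ^ 2 + x - x ^ 2) := by
    rw [← hprod, div_add_div _ _ ha.ne' hb.ne']
    congr 1
    ring
  have hpos : 0 < σ ^ 2 + x - x ^ 2 := hprod ▸ mul_pos ha hb
  have hd : 0 < σ - 1 + x := by linarith
  rw [hsum, div_mul_div_comm, one_mul, div_le_div_iff₀ (by positivity) hd, one_mul]
  calc r * (σ - 1 + x) ≤ Real.sqrt 5 * σ * (σ - 1 + x) := by gcongr
    _ = Real.sqrt 5 * (σ * (σ - 1 + x)) := by ring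
    _ ≤ Real.sqrt 5 * (σ ^ 2 + x - x ^ 2) := by
      gcongr
      nlinarith [mul_nonneg (sub_nonneg.2 h1.le) (by linarith : (0 : ℝ) ≤ x + σ)]

/-- Stechkin's lemma, second inequality: for `s = σ + it` with `σ > 1`,
`s1 = σ1 + it`, `Im z = t` and `1/2 ≤ Re z < 1`, one has
`Re(1/(s-1+conj z)) - κ F(s1,z) ≥ 0`. -/
theorem stechkin_second (σ t : ℝ) (hσ : 1 < σ) (z : ℂ) (him : z.im = t)
    (h0 : 1 / 2 ≤ z.re) (h1 : z.re < 1) :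
    0 ≤ (1 / (((σ : ℂ) + (t : ℂ) * Complex.I) - 1 + (starRingEnd ℂ) z)).re
        - kappa * F ((sigma1 σ : ℂ) + (t : ℂ) * Complex.I) z := by
  have hconj (a : ℝ) : (a : ℂ) + (t : ℂ) * Complex.I - 1 + (starRingEnd ℂ) z
      = ((a - 1 + z.re : ℝ) : ℂ) := by
    apply Complex.ext <;> simp [him]
  have hsub (a : ℝ) : (a : ℂ) + (t : ℂ) * Complex.I - z = ((a - z.re : ℝ) : ℂ) := by
    apply Complex.ext <;> simp [him]
  have hre (a : ℝ) : (1 / (a : ℂ)).re = 1 / a := by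
    rw [← Complex.ofReal_one, ← Complex.ofReal_div, Complex.ofReal_re]
  rw [F, hconj, hconj, hsub, Complex.add_re, hre, hre, hre, sub_nonneg]
  exact kappa_mul_add_le hσ h0 h1

end ZFR
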